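/- Let T be a complete first-order theory and φ(x;y) a partitioned formula. Then φ(x;y) is Shelah straight maximal in T if and only if φ(x;y) is straight up maximal in T, i.e. φ exhibits every exhibitable pattern in T. -/

import Mathlib

open FirstOrder Language Set

universe u v w

/-- A partitioned formula `φ(x;y)` (object variables `α`, parameter variables `β`)
exhibits the pattern `(C, I)` (indexed by `S`) in the theory `T`. -/
def ExhibitsPattern {L : FirstOrder.Language.{u, v}} (T : L.Theory) {α β S : Type*}
    (φ : L.Formula (α ⊕ β)) (C I : Set (Set S × Set S)) : Prop :=
  ∃ (M : Theory.ModelType.{u, v, w} T) (b : S → β → M),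
    (∀ p ∈ C, ∃ a : α → M,
      (∀ i ∈ p.1, φ.Realize (Sum.elim a (b i))) ∧
      (∀ j ∈ p.2, ¬ φ.Realize (Sum.elim a (b j)))) ∧
    (∀ p ∈ I, ¬ ∃ a : α → M,
      (∀ i ∈ p.1, φ.Realize (Sum.elim a (b i))) ∧
      (∀ j ∈ p.2, ¬ φ.Realize (Sum.elim a (b j))))

/-- `(C, I)` is a pattern: the condition `(∅, ∅)` is excluded. -/
def IsPattern {S : Type*} (C I : Set (Set S × Set S)) : Prop :=
  (∅, ∅) ∉ C ∧ (∅, ∅) ∉ I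

/-- A pattern is exhibitable if some partitioned formula of some complete
first-order theory exhibits it. -/
def Exhibitable {S : Type*} (C I : Set (Set S × Set S)) : Prop :=
  ∃ (L : FirstOrder.Language.{0, 0}) (T : L.Theory) (_ : T.IsComplete) (α β : Type)
    (φ : L.Formula (α ⊕ β)), ExhibitsPattern.{0, 0, 0} T φ C I

/-- `φ(x;y)` is Shelah straight maximal in `T`. -/
def ShelahSM {L : FirstOrder.Language.{u, v}} (T : L.Theory) {α β : Type*}
    (φ : L.Formula (α ⊕ β)) : Prop :=
  ∀ (n : ℕ) (F : Set (Set (Fin n))), F.Nonempty →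
    ∃ (M : Theory.ModelType.{u, v, w} T) (b : Fin n → β → M),
      ∀ X : Set (Fin n),
        X ∈ F ↔ ∃ a : α → M, ∀ i : Fin n, (φ.Realize (Sum.elim a (b i)) ↔ i ∈ X)

/-- `φ(x;y)` is straight up maximal in `T`: it exhibits every exhibitable pattern. -/
def StraightUpMaximal {L : FirstOrder.Language.{u, v}} (T : L.Theory) {α β : Type*}
    (φ : L.Formula (α ⊕ β)) : Prop :=
  ∀ (n : ℕ) (C I : Set (Set (Fin n) × Set (Fin n))),
    IsPattern C I → Exhibitable C I → ExhibitsPattern.{u, v, w} T φ C I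

theorem exhibitable_of_family {n : ℕ} (F : Set (Set (Fin n))) (hF : F.Nonempty) :
    Exhibitable {p : Set (Fin n) × Set (Fin n) | p.1 ∈ F ∧ p.2 = p.1ᶜ}
      {p : Set (Fin n) × Set (Fin n) | p.1 ∉ F ∧ p.2 = p.1ᶜ} := by
  obtain ⟨X0, hX0⟩ := hF
  let L : FirstOrder.Language.{0, 0} := ⟨fun _ => Empty, fun _ => Unit⟩
  let N : Type := ℕ × F
  let R : Unit → Set (N × N) := fun _ => {q | ∃ h : q.2.1 < n, (⟨q.2.1, h⟩ : Fin n) ∈ q.1.2.1}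
  let str : L.Structure N :=
    { funMap := fun f _ => Empty.elim f
      RelMap := fun {k} _ xs => ∃ h : k = 2,
        (xs (Fin.cast h.symm 0), xs (Fin.cast h.symm 1)) ∈ R () }
  have : Nonempty N := ⟨(0, ⟨X0, hX0⟩)⟩
  let r : L.Relations 2 := ()
  let φ : L.Formula (Unit ⊕ Unit) :=
    r.formula₂ (Term.var (Sum.inl ())) (Term.var (Sum.inr ()))
  have hφ : ∀ (a b : Unit → N), φ.Realize (Sum.elim a b) ↔ (a (), b ()) ∈ R () := by
    intro a b
    simp only [φ]
    rw [Formula.realize_rel₂]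
    simp only [Term.realize_var, Sum.elim_inl, Sum.elim_inr]
    exact ⟨fun ⟨_, h⟩ => h, fun h => ⟨rfl, h⟩⟩
  refine ⟨L, L.completeTheory N, completeTheory.isComplete L N, Unit, Unit, φ,
    Theory.ModelType.of _ N, fun i _ => (i.1, ⟨X0, hX0⟩), ?_, ?_⟩
  · rintro ⟨X, Y⟩ ⟨hX, hY⟩
    simp only at hX hY
    subst hY
    refine ⟨fun _ => (0, ⟨X, hX⟩), fun i hi => ?_, fun i hi => ?_⟩
    · exact (hφ _ _).2 ⟨i.2, hi⟩
    · intro h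
      obtain ⟨_, h⟩ := (hφ _ _).1 h
      exact hi h
  · rintro ⟨X, Y⟩ ⟨hX, hY⟩ ⟨a, h1, h2⟩
    simp only at hX hY h1 h2
    subst hY
    apply hX
    have : X = (show N from a ()).2.1 := by
      ext i
      constructor
      · intro hi
        obtain ⟨_, h⟩ := (hφ _ _).1 (h1 i hi)
        exact h
      · intro hi
        by_contra hc
        exact h2 i hc ((hφ _ _).2 ⟨i.2, hi⟩)
    rw [this]
    exact (show N from a ()).2.2

/-- `φ(x;y)` is Shelah straight maximal in the complete theory `T` iff it is
straight up maximal in `T`. -/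
theorem shelahSM_iff_straightUpMaximal
    {L : FirstOrder.Language.{u, v}} (T : L.Theory) (hT : T.IsComplete)
    {α β : Type*} (φ : L.Formula (α ⊕ β)) :
    ShelahSM.{u, v, w} T φ ↔ StraightUpMaximal.{u, v, w} T φ := by
  constructor
  · rintro h n C I - ⟨L', T', -, α', β', ψ, M', b', hC, hI⟩
    obtain ⟨M, b, hb⟩ := h n
      {X | ∃ a : α' → M', ∀ i : Fin n, (ψ.Realize (Sum.elim a (b' i)) ↔ i ∈ X)}
      ⟨{i | ψ.Realize (Sum.elim (fun _ => Classical.arbitrary M') (b' i))},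
        fun _ => Classical.arbitrary M', fun i => Iff.rfl⟩
    refine ⟨M, b, fun p hp => ?_, fun p hp => ?_⟩
    · obtain ⟨a', h1, h2⟩ := hC p hp
      obtain ⟨a, ha⟩ := (hb {i | ψ.Realize (Sum.elim a' (b' i))}).1 ⟨a', fun i => Iff.rfl⟩
      exact ⟨a, fun i hi => (ha i).2 (h1 i hi), fun i hi hc => h2 i hi ((ha i).1 hc)⟩
    · rintro ⟨a, h1, h2⟩
      obtain ⟨a', ha⟩ := (hb {i | φ.Realize (Sum.elim a (b i))}).2 ⟨a, fun i => Iff.rfl⟩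
      exact hI p hp ⟨a', fun i hi => (ha i).2 (h1 i hi), fun i hi hc => h2 i hi ((ha i).1 hc)⟩
  · intro h n F hF
    rcases n with _ | n
    · have he : Exhibitable (S := Fin 1) ∅ ∅ := by
        obtain ⟨L', T', hT', α', β', ψ, M', b', -⟩ :=
          exhibitable_of_family (n := 1) Set.univ Set.univ_nonempty
        exact ⟨L', T', hT', α', β', ψ, M', b', by simp, by simp⟩
      obtain ⟨M, -⟩ := h 1 ∅ ∅ ⟨by simp, by simp⟩ he
      refine ⟨M, fun i => i.elim0, fun X => ?_⟩
      obtain ⟨Y, hY⟩ := hF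
      have : X = Y := Subsingleton.elim _ _
      subst this
      exact ⟨fun _ => ⟨fun _ => Classical.arbitrary M, fun i => i.elim0⟩, fun _ => hY⟩
    · have hp : ∀ P : Set (Fin (n+1)) → Prop, ((∅, ∅) : Set (Fin (n+1)) × Set (Fin (n+1))) ∉
          {p : Set (Fin (n+1)) × Set (Fin (n+1)) | P p.1 ∧ p.2 = p.1ᶜ} := by
        rintro P ⟨-, h⟩
        have : (0 : Fin (n+1)) ∈ (∅ : Set (Fin (n+1)))ᶜ := by simp
        have h' : (∅ : Set (Fin (n+1))) = ∅ᶜ := h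
        rw [← h'] at this
        exact this
      obtain ⟨M, b, hC, hI⟩ := h (n+1) _ _ ⟨hp (· ∈ F), hp (· ∉ F)⟩ (exhibitable_of_family F hF)
      refine ⟨M, b, fun X => ⟨fun hX => ?_, ?_⟩⟩
      · obtain ⟨a, h1, h2⟩ := hC (X, Xᶜ) ⟨hX, rfl⟩
        exact ⟨a, fun i => ⟨fun hr => by_contra fun hc => h2 i hc hr, h1 i⟩⟩
      · rintro ⟨a, ha⟩
        by_contra hX
        exact hI (X, Xᶜ) ⟨hX, rfl⟩ ⟨a, fun i hi => (ha i).2 hi, fun i hi hc => hi ((ha i).1 hc)⟩
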